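/- arXiv:1411.2478 — 3 statements merged into one kernel-verified Lean document; each statement's English description precedes it below -/
import Mathlib

section
/- Let p ≥ 1 be a real number, h > 0, and let f : ℝ → ℝ be continuously differentiable on the interval [0,h]. Then |f(0)|^p ≤ h⁻¹ ∫₀^h |f(t)|^p dt + p ∫₀^h |f(t)|^(p-1) |f'(t)| dt. -/
open MeasureTheory

/-- For `p ≥ 1` some function of absolute value `|x| ^ p` is differentiable on the whole line, with
derivative of absolute value `p * |x| ^ (p - 1)`. -/
theorem exists_hasDerivAt_abs_eq_abs_rpow {p : ℝ} (hp : 1 ≤ p) :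
    ∃ φ φ' : ℝ → ℝ, ∀ x, HasDerivAt φ (φ' x) x ∧ |φ x| = |x| ^ p ∧
      |φ' x| = p * |x| ^ (p - 1) := by
  rcases hp.eq_or_lt with rfl | hp
  · exact ⟨id, fun _ => 1, fun x => ⟨hasDerivAt_id x, by simp, by simp⟩⟩
  · refine ⟨fun x => |x| ^ p, fun x => p * |x| ^ (p - 2) * x, fun x =>
      ⟨hasDerivAt_abs_rpow x hp, abs_of_nonneg (by positivity), ?_⟩⟩
    rw [abs_mul, abs_of_nonneg (by positivity), mul_assoc]
    rcases eq_or_ne x 0 with rfl | hx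
    · simp [Real.zero_rpow (sub_pos.2 hp).ne']
    · rw [← Real.rpow_add_one (abs_pos.2 hx).ne']
      ring_nf

/-- The oscillation of `|f| ^ p` on an interval is controlled by the integral of
`p * |f| ^ (p - 1) * |f'|`. -/
theorem abs_rpow_sub_abs_rpow_le_integral {p a b : ℝ} (hp : 1 ≤ p) (hab : a ≤ b) {f : ℝ → ℝ}
    (hfc : ContinuousOn f (Set.Icc a b)) (hfd : ∀ x ∈ Set.Ioo a b, DifferentiableAt ℝ f x)
    (hint : IntervalIntegrable (fun t => |f t| ^ (p - 1) * |deriv f t|) volume a b) :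
    |f a| ^ p - |f b| ^ p ≤ p * ∫ t in a..b, |f t| ^ (p - 1) * |deriv f t| := by
  obtain ⟨φ, φ', hφ⟩ := exists_hasDerivAt_abs_eq_abs_rpow hp
  have hd : ∀ x ∈ Set.Ioo a b, HasDerivAt (φ ∘ f) (φ' (f x) * deriv f x) x :=
    fun x hx => (hφ (f x)).1.comp x (hfd x hx).hasDerivAt
  have hφc : Continuous φ := continuous_iff_continuousAt.2 fun x => (hφ x).1.continuousAt
  have key := norm_sub_le_integral_of_norm_deriv_le_of_le
    (B := fun t => p * (|f t| ^ (p - 1) * |deriv f t|)) hab (hφc.comp_continuousOn hfc)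
    (fun x hx => (hd x hx).differentiableAt.differentiableWithinAt)
    (.of_forall fun x hx => by
      rw [(hd x hx).deriv, Real.norm_eq_abs, abs_mul, (hφ _).2.2, mul_assoc])
    (hint.const_mul p)
  rw [intervalIntegral.integral_const_mul, Real.norm_eq_abs, abs_sub_comm] at key
  rw [← (hφ (f a)).2.1, ← (hφ (f b)).2.1]
  exact (abs_sub_abs_le_abs_sub _ _).trans key

/-- One-dimensional trace inequality: for `p ≥ 1`, `h > 0` and `f` continuously
differentiable on `[0,h]`,
`|f 0|^p ≤ h⁻¹ ∫₀^h |f t|^p dt + p ∫₀^h |f t|^(p-1) |f' t| dt`. -/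
theorem stmt_0 (p h : ℝ) (hp : 1 ≤ p) (hh : 0 < h) (f : ℝ → ℝ)
    (hf : ContDiffOn ℝ 1 f (Set.Icc 0 h)) :
    |f 0| ^ p ≤
      h⁻¹ * (∫ t in (0:ℝ)..h, |f t| ^ p) +
        p * (∫ t in (0:ℝ)..h, |f t| ^ (p - 1) * |deriv f t|) := by
  have hfc := hf.continuousOn
  have hfd : ∀ x ∈ Set.Ioo 0 h, DifferentiableAt ℝ f x := fun x hx =>
    (hf.differentiableOn one_ne_zero).differentiableAt (Icc_mem_nhds hx.1 hx.2)
  have hint : IntervalIntegrable (fun t => |f t| ^ (p - 1) * |deriv f t|) volume 0 h := by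
    have hc : ContinuousOn (fun t => |f t| ^ (p - 1) * |derivWithin f (Set.Icc 0 h) t|)
        (Set.Icc 0 h) :=
      (hfc.abs.rpow_const fun _ _ => Or.inr (sub_nonneg.2 hp)).mul
        (hf.continuousOn_derivWithin (uniqueDiffOn_Icc hh) le_rfl).abs
    rw [intervalIntegrable_iff_integrableOn_Ioo_of_le hh.le]
    refine (hc.integrableOn_Icc.mono_set Set.Ioo_subset_Icc_self).congr_fun (fun x hx => ?_)
      measurableSet_Ioo
    simp only [derivWithin_of_mem_nhds (Icc_mem_nhds hx.1 hx.2)]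
  set J := ∫ t in (0:ℝ)..h, |f t| ^ (p - 1) * |deriv f t|
  have hle : ∀ s ∈ Set.Icc 0 h, |f 0| ^ p - p * J ≤ |f s| ^ p := fun s hs => by
    have h₁ := abs_rpow_sub_abs_rpow_le_integral hp hs.1
      (hfc.mono (Set.Icc_subset_Icc_right hs.2))
      (fun x hx => hfd x ⟨hx.1, hx.2.trans_le hs.2⟩)
      (hint.mono_set (by
        rw [Set.uIcc_of_le hs.1, Set.uIcc_of_le hh.le]
        exact Set.Icc_subset_Icc_right hs.2))
    have h₂ : ∫ t in (0:ℝ)..s, |f t| ^ (p - 1) * |deriv f t| ≤ J :=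
      intervalIntegral.integral_mono_interval le_rfl hs.1 hs.2
        (.of_forall fun t => by dsimp only [Pi.zero_apply]; positivity) hint
    have h₃ := mul_le_mul_of_nonneg_left h₂ (zero_le_one.trans hp)
    linarith
  have hmean := intervalIntegral.integral_mono_on (μ := volume) hh.le intervalIntegrable_const
    ((hfc.abs.rpow_const fun _ _ => Or.inr (zero_le_one.trans hp)).intervalIntegrable_of_Icc hh.le)
    hle
  rw [intervalIntegral.integral_const, sub_zero, smul_eq_mul] at hmean
  have := (le_inv_mul_iff₀ hh).2 hmean
  linarith
end

section
/- Let p ≥ 1 be a real number, h > 0, and let f : ℝ → ℝ be continuously differentiable on the interval [0,h]. Then |f(0)|^p ≤ p h⁻¹ ∫₀^h |f(t)|^p dt + h^(p-1) ∫₀^h |f'(t)|^p dt. -/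
open MeasureTheory

/-- Young's inequality in the form `p a^(p-1) b ≤ (p-1) a^p + b^p`. -/
theorem mul_rpow_sub_one_mul_le {p a b : ℝ} (hp : 1 ≤ p) (ha : 0 ≤ a) (hb : 0 ≤ b) :
    p * (a ^ (p - 1) * b) ≤ (p - 1) * a ^ p + b ^ p := by
  have hp0 : 0 < p := by linarith
  have key := Real.geom_mean_le_arith_mean2_weighted (w₁ := (p - 1) / p) (w₂ := 1 / p)
    (div_nonneg (by linarith) hp0.le) (by positivity)
    (Real.rpow_nonneg ha p) (Real.rpow_nonneg hb p) (by field_simp; ring)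
  rw [← Real.rpow_mul ha, ← Real.rpow_mul hb, mul_div_cancel₀ _ hp0.ne',
    mul_div_cancel₀ _ hp0.ne', Real.rpow_one] at key
  calc p * (a ^ (p - 1) * b) ≤ p * ((p - 1) / p * a ^ p + 1 / p * b ^ p) := by gcongr
    _ = (p - 1) * a ^ p + b ^ p := by field_simp

/-- The signed power `x |x|^r` is differentiable for every `r ≥ 0`. -/
theorem hasDerivAt_mul_abs_rpow {r : ℝ} (hr : 0 ≤ r) (x : ℝ) :
    HasDerivAt (fun y : ℝ => y * |y| ^ r) ((r + 1) * |x| ^ r) x := by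
  rcases hr.eq_or_lt with rfl | hr0
  · simpa using hasDerivAt_id' x
  have hne : ∀ y : ℝ, y ≠ 0 →
      HasDerivAt (fun y : ℝ => y * |y| ^ r) ((r + 1) * |y| ^ r) y := by
    intro y hy
    have h1 := (hasDerivAt_id' y).mul
      ((hasDerivAt_abs hy).rpow_const (p := r) (Or.inl (abs_ne_zero.mpr hy)))
    refine h1.congr_deriv ?_
    have h2 : y * (SignType.sign y : ℝ) = |y| := self_mul_sign y
    have h3 : |y| * |y| ^ (r - 1) = |y| ^ r := by
      rw [Real.rpow_sub_one (abs_ne_zero.mpr hy), mul_div_cancel₀ _ (abs_ne_zero.mpr hy)]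
    linear_combination (r * |y| ^ (r - 1)) * h2 + r * h3
  have hc : Continuous fun y : ℝ => |y| ^ r := continuous_abs.rpow_const fun _ => Or.inr hr
  by_cases hx : x = 0
  · subst hx
    exact hasDerivAt_of_hasDerivAt_of_ne hne (continuous_id.mul hc).continuousAt
      (continuous_const.mul hc).continuousAt
  · exact hne x hx

theorem abs_mul_abs_rpow_sub_one {p : ℝ} (hp : 1 ≤ p) (x : ℝ) :
    |x * |x| ^ (p - 1)| = |x| ^ p := by
  rw [abs_mul, abs_of_nonneg (Real.rpow_nonneg (abs_nonneg x) _)]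
  nth_rewrite 1 [← Real.rpow_one |x|]
  rw [← Real.rpow_add_of_nonneg (abs_nonneg x) zero_le_one (by linarith)]
  ring_nf

/-- Scaled one-dimensional trace inequality: for `p ≥ 1`, `h > 0` and `f` continuously
differentiable on `[0,h]`,
`|f 0|^p ≤ p h⁻¹ ∫₀^h |f t|^p dt + h^(p-1) ∫₀^h |f' t|^p dt`. -/
theorem stmt_1 (p h : ℝ) (hp : 1 ≤ p) (hh : 0 < h) (f : ℝ → ℝ)
    (hf : ContDiffOn ℝ 1 f (Set.Icc 0 h)) :
    |f 0| ^ p ≤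
      p * h⁻¹ * (∫ t in (0:ℝ)..h, |f t| ^ p) +
        h ^ (p - 1) * (∫ t in (0:ℝ)..h, |deriv f t| ^ p) := by
  have hp0 : 0 ≤ p := by linarith
  have hp1 : 0 ≤ p - 1 := by linarith
  set d : ℝ → ℝ := derivWithin f (Set.Icc 0 h) with hd
  have hdc : ContinuousOn d (Set.Icc 0 h) :=
    hf.continuousOn_derivWithin (uniqueDiffOn_Icc hh) le_rfl
  have hfc := hf.continuousOn
  have hderiv : ∀ t ∈ Set.Ioo 0 h, HasDerivAt f (d t) t := fun t ht =>
    ((hf.differentiableOn one_ne_zero t (Set.Ioo_subset_Icc_self ht)).hasDerivWithinAt).hasDerivAt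
      (Icc_mem_nhds ht.1 ht.2)
  have hint : ∫ t in (0:ℝ)..h, |deriv f t| ^ p = ∫ t in (0:ℝ)..h, |d t| ^ p := by
    rw [intervalIntegral.integral_of_le hh.le, intervalIntegral.integral_of_le hh.le,
      integral_Ioc_eq_integral_Ioo, integral_Ioc_eq_integral_Ioo]
    exact setIntegral_congr_fun measurableSet_Ioo fun t ht => by
      simp only [(hderiv t ht).deriv]
  have hpow : ContinuousOn (fun t => |f t| ^ (p - 1)) (Set.Icc 0 h) :=
    hfc.abs.rpow_const fun _ _ => Or.inr hp1
  have hfp : ContinuousOn (fun t => |f t| ^ p) (Set.Icc 0 h) :=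
    hfc.abs.rpow_const fun _ _ => Or.inr hp0
  have hdp : ContinuousOn (fun t => |d t| ^ p) (Set.Icc 0 h) :=
    hdc.abs.rpow_const fun _ _ => Or.inr hp0
  have hsub : ContinuousOn (fun t : ℝ => h - t) (Set.Icc 0 h) := by fun_prop
  set G' : ℝ → ℝ := fun t =>
    -1 * (f t * |f t| ^ (p - 1)) + (h - t) * ((p - 1 + 1) * |f t| ^ (p - 1) * d t) with hG'
  have hG'c : ContinuousOn G' (Set.Icc 0 h) :=
    (continuousOn_const.mul (hfc.mul hpow)).add
      (hsub.mul ((continuousOn_const.mul hpow).mul hdc))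
  have hftc : ∫ t in (0:ℝ)..h, G' t =
      (h - h) * (f h * |f h| ^ (p - 1)) - (h - 0) * (f 0 * |f 0| ^ (p - 1)) :=
    intervalIntegral.integral_eq_sub_of_hasDerivAt_of_le hh.le
      (f := fun t => (h - t) * (f t * |f t| ^ (p - 1))) (hsub.mul (hfc.mul hpow))
      (fun t ht => ((hasDerivAt_id' t).const_sub h).mul
        ((hasDerivAt_mul_abs_rpow hp1 (f t)).comp t (hderiv t ht)))
      (hG'c.intervalIntegrable_of_Icc hh.le)
  have hbound : ∀ t ∈ Set.Icc 0 h, ‖G' t‖ ≤ p * |f t| ^ p + h ^ p * |d t| ^ p := by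
    intro t ht
    have hy := mul_rpow_sub_one_mul_le hp (abs_nonneg (f t))
      (mul_nonneg hh.le (abs_nonneg (d t)))
    rw [Real.mul_rpow hh.le (abs_nonneg _)] at hy
    have hnn : 0 ≤ |f t| ^ (p - 1) := Real.rpow_nonneg (abs_nonneg _) _
    calc ‖G' t‖ ≤ |-1 * (f t * |f t| ^ (p - 1))|
          + |(h - t) * ((p - 1 + 1) * |f t| ^ (p - 1) * d t)| := abs_add_le _ _
      _ = |f t| ^ p + (h - t) * (p * |f t| ^ (p - 1) * |d t|) := by
          rw [neg_one_mul, abs_neg, abs_mul_abs_rpow_sub_one hp, sub_add_cancel, abs_mul,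
            abs_mul, abs_mul, abs_of_nonneg hnn, abs_of_nonneg hp0,
            abs_of_nonneg (sub_nonneg.mpr ht.2)]
      _ ≤ |f t| ^ p + h * (p * |f t| ^ (p - 1) * |d t|) := by
          gcongr
          linarith [ht.1]
      _ ≤ p * |f t| ^ p + h ^ p * |d t| ^ p := by linarith
  have hifp := hfp.intervalIntegrable_of_Icc (μ := volume) hh.le
  have hidp := hdp.intervalIntegrable_of_Icc (μ := volume) hh.le
  have hle := intervalIntegral.norm_integral_le_of_norm_le hh.le
    (Filter.Eventually.of_forall fun t ht => hbound t (Set.Ioc_subset_Icc_self ht))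
    ((hifp.const_mul p).add (hidp.const_mul (h ^ p)))
  rw [hftc, sub_self, zero_mul, zero_sub, sub_zero, norm_neg, Real.norm_eq_abs, abs_mul,
    abs_mul_abs_rpow_sub_one hp, abs_of_pos hh,
    intervalIntegral.integral_add (hifp.const_mul p) (hidp.const_mul (h ^ p)),
    intervalIntegral.integral_const_mul, intervalIntegral.integral_const_mul] at hle
  rw [hint, Real.rpow_sub_one hh.ne']
  calc |f 0| ^ p = h⁻¹ * (h * |f 0| ^ p) := by field_simp
    _ ≤ h⁻¹ * (p * (∫ t in (0:ℝ)..h, |f t| ^ p) + h ^ p * ∫ t in (0:ℝ)..h, |d t| ^ p) := by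
        gcongr
    _ = _ := by ring
end

section
/- For every integer k ≥ 0 and every real p ∈ [1,∞), there exists a constant C = C(k,p) > 0 such that for every real polynomial q of degree at most k and every h > 0: ∫₀^h |q'(t)|^p dt ≤ C h^(-p) ∫₀^h |q(t)|^p dt, where q' denotes the derivative polynomial. -/
open MeasureTheory

/-- On a finite-dimensional space, a continuous `p`-homogeneous function is bounded by a multiple
of any continuous `p`-homogeneous function which is positive away from the origin. -/
theorem exists_le_mul_of_homogeneous {E : Type*} [NormedAddCommGroup E] [NormedSpace ℝ E]
    [FiniteDimensional ℝ E] {p : ℝ} {F G : E → ℝ} (hF : Continuous F) (hG : Continuous G)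
    (hFp : ∀ (a : ℝ) (x : E), 0 ≤ a → F (a • x) = a ^ p * F x)
    (hGp : ∀ (a : ℝ) (x : E), 0 ≤ a → G (a • x) = a ^ p * G x)
    (hpos : ∀ x, x ≠ 0 → 0 < F x) :
    ∃ C > 0, ∀ x, x ≠ 0 → G x ≤ C * F x := by
  have hcont : ContinuousOn (fun x => G x / F x) (Metric.sphere (0 : E) 1) :=
    hG.continuousOn.div hF.continuousOn fun x hx =>
      (hpos x (ne_zero_of_mem_unit_sphere ⟨x, hx⟩)).ne'
  have := FiniteDimensional.proper ℝ E
  obtain ⟨B, hB⟩ := (isCompact_sphere (0 : E) 1).bddAbove_image hcont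
  refine ⟨max B 1, by positivity, fun x hx => ?_⟩
  have hx' : 0 < ‖x‖ := norm_pos_iff.mpr hx
  have hmem : ‖x‖⁻¹ • x ∈ Metric.sphere (0 : E) 1 := by
    simp [norm_smul, hx'.ne']
  have hle := hB (Set.mem_image_of_mem _ hmem)
  have ha : 0 < ‖x‖⁻¹ ^ p := by positivity
  simp only [hFp _ x (inv_nonneg.mpr hx'.le), hGp _ x (inv_nonneg.mpr hx'.le),
    mul_div_mul_left _ _ ha.ne'] at hle
  exact (div_le_iff₀ (hpos x hx)).mp (hle.trans (le_max_left _ _))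

theorem Polynomial.integral_abs_eval_rpow_pos {p : ℝ} (hp : 0 ≤ p) {q : Polynomial ℝ}
    (hq : q ≠ 0) : 0 < ∫ t in (0:ℝ)..1, |q.eval t| ^ p := by
  have hcont : Continuous fun t : ℝ => |q.eval t| ^ p :=
    q.continuous.abs.rpow_const fun _ => Or.inr hp
  obtain ⟨t, ht, hqt⟩ : ∃ t ∈ Set.Icc (0:ℝ) 1, q.eval t ≠ 0 := by
    by_contra! h
    exact hq (Polynomial.eq_zero_of_infinite_isRoot q
      ((Set.Icc_infinite zero_lt_one).mono fun t ht => h t ht))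
  exact intervalIntegral.integral_pos zero_lt_one hcont.continuousOn
    (fun _ _ => by positivity) ⟨t, ht, by positivity⟩

/-- The integral of `|q|ᵖ` over `[0, 1]` depends continuously on the parameters of `q`. -/
theorem continuous_integral_abs_sum_rpow {ι : Type*} [Fintype ι] {p : ℝ} (hp : 0 ≤ p)
    {f : ι → ℝ → ℝ} (hf : ∀ i, Continuous (f i)) :
    Continuous fun c : ι → ℝ => ∫ t in (0:ℝ)..1, |∑ i, c i * f i t| ^ p := by
  apply intervalIntegral.continuous_parametric_intervalIntegral_of_continuous'
  have : Continuous fun x : (ι → ℝ) × ℝ => ∑ i, x.1 i * f i x.2 := by fun_prop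
  exact this.abs.rpow_const fun _ => Or.inr hp

theorem integral_abs_sum_smul_rpow {ι : Type*} [Fintype ι] {p : ℝ} (f : ι → ℝ → ℝ)
    (a : ℝ) (c : ι → ℝ) (ha : 0 ≤ a) :
    (∫ t in (0:ℝ)..1, |∑ i, (a • c) i * f i t| ^ p) =
      a ^ p * ∫ t in (0:ℝ)..1, |∑ i, c i * f i t| ^ p := by
  rw [← intervalIntegral.integral_const_mul]
  congr 1 with t
  simp only [Pi.smul_apply, smul_eq_mul, mul_assoc, ← Finset.mul_sum, abs_mul, abs_of_nonneg ha]
  exact Real.mul_rpow ha (abs_nonneg _)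

/-- The inverse inequality on the unit interval. -/
theorem Polynomial.exists_integral_derivative_le_unitInterval (k : ℕ) {p : ℝ} (hp : 0 < p) :
    ∃ C > 0, ∀ q : Polynomial ℝ, q.natDegree ≤ k →
      (∫ t in (0:ℝ)..1, |(derivative q).eval t| ^ p) ≤ C * ∫ t in (0:ℝ)..1, |q.eval t| ^ p := by
  let P : (Fin (k + 1) → ℝ) → Polynomial ℝ := fun c => ∑ i, C (c i) * X ^ (i : ℕ)
  let f : Fin (k + 1) → ℝ → ℝ := fun i t => t ^ (i : ℕ)
  let g : Fin (k + 1) → ℝ → ℝ := fun i t => i * t ^ ((i : ℕ) - 1)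
  have hPf (c) (t : ℝ) : (P c).eval t = ∑ i, c i * f i t := by
    simp [P, f, eval_finsetSum]
  have hPg (c) (t : ℝ) : (derivative (P c)).eval t = ∑ i, c i * g i t := by
    simp [P, g, eval_finsetSum, derivative_X_pow]
  have hcoeff (c) (i : Fin (k + 1)) : (P c).coeff i = c i := by
    simp [P, coeff_X_pow, Fin.val_inj]
  obtain ⟨K, hK, hle⟩ := exists_le_mul_of_homogeneous
    (continuous_integral_abs_sum_rpow hp.le (f := f) fun i => by fun_prop)
    (continuous_integral_abs_sum_rpow hp.le (f := g) fun i => by fun_prop)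
    (integral_abs_sum_smul_rpow (p := p) f) (integral_abs_sum_smul_rpow (p := p) g)
    (fun c hc => by
      simp only [← hPf]
      refine integral_abs_eval_rpow_pos hp.le fun h0 => hc ?_
      ext i
      rw [← hcoeff c i, h0, coeff_zero, Pi.zero_apply])
  refine ⟨K, hK, fun q hq => ?_⟩
  rcases eq_or_ne q 0 with rfl | hq0
  · simp [Real.zero_rpow hp.ne']
  have hqP : P (fun i => q.coeff i) = q := by
    conv_rhs => rw [q.as_sum_range_C_mul_X_pow' (Nat.lt_succ_of_le hq)]
    exact Fin.sum_univ_eq_sum_range (fun i => C (q.coeff i) * X ^ i) (k + 1)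
  have hne : (fun i : Fin (k + 1) => q.coeff i) ≠ 0 := by
    intro h
    apply hq0
    rw [← hqP, h]
    simp [P]
  simpa only [← hPf, ← hPg, hqP] using hle _ hne

/-- One-dimensional inverse inequality for polynomials (Lemma 2): for every `k` and
`p ∈ [1,∞)` there is `C = C(k,p) > 0` such that for every polynomial `q` of degree
at most `k` and every `h > 0`,
`∫₀^h |q'(t)|^p dt ≤ C h^(-p) ∫₀^h |q(t)|^p dt`. -/
theorem stmt_4 (k : ℕ) (p : ℝ) (hp : 1 ≤ p) :
    ∃ C > 0, ∀ q : Polynomial ℝ, q.natDegree ≤ k → ∀ h : ℝ, 0 < h →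
      (∫ t in (0:ℝ)..h, |(Polynomial.derivative q).eval t| ^ p) ≤
        C * h ^ (-p) * ∫ t in (0:ℝ)..h, |q.eval t| ^ p := by
  obtain ⟨K, hK, hle⟩ :=
    Polynomial.exists_integral_derivative_le_unitInterval k (zero_lt_one.trans_le hp)
  refine ⟨K, hK, fun q hq h hh => ?_⟩
  have hscale (u : ℝ → ℝ) : (∫ t in (0:ℝ)..h, u t) = h * ∫ t in (0:ℝ)..1, u (h * t) := by
    simp [intervalIntegral.mul_integral_comp_mul_left]
  have hr := hle (q.comp (Polynomial.C h * Polynomial.X)) <| by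
    rw [Polynomial.natDegree_comp, Polynomial.natDegree_C_mul_X _ hh.ne', mul_one]
    exact hq
  simp only [Polynomial.derivative_comp, Polynomial.derivative_C_mul, Polynomial.derivative_X,
    mul_one, Polynomial.eval_mul, Polynomial.eval_comp, Polynomial.eval_C, Polynomial.eval_X,
    abs_mul, abs_of_pos hh, Real.mul_rpow hh.le (abs_nonneg _),
    intervalIntegral.integral_const_mul] at hr
  rw [hscale, hscale fun t => |q.eval t| ^ p, Real.rpow_neg hh.le]
  have hhp : 0 < h ^ p := by positivity
  calc _ ≤ h * ((K * ∫ t in (0:ℝ)..1, |q.eval (h * t)| ^ p) / h ^ p) := by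
        gcongr
        rw [le_div_iff₀' hhp]
        exact hr
    _ = _ := by ring
end
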